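/- If G is a nonhamiltonian graph on n ≥ 3 vertices, then there exists an integer k with 1 ≤ k ≤ ⌊(n-1)/2⌋ such that G has a set of k vertices each of degree at most k. -/

import Mathlib

namespace SimpleGraph

variable {V : Type*} [Fintype V] [DecidableEq V] {G : SimpleGraph V} {u v : V}

/-- A Hamiltonian path whose endpoints are adjacent closes up to a Hamiltonian cycle. -/
lemma Walk.IsHamiltonian.isHamiltonian_of_adj {p : G.Walk u v} (hp : p.IsHamiltonian)
    (hcard : 3 ≤ Fintype.card V) (h : G.Adj v u) : G.IsHamiltonian := by
  have hlen := hp.length_eq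
  refine fun _ ↦ ⟨v, .cons h p, Walk.isHamiltonianCycle_iff_isCycle_and_length_eq.mpr
    ⟨Walk.isCycle_iff_isPath_tail_and_le_length.mpr ⟨?_, ?_⟩, ?_⟩⟩
  · simpa using hp.isPath
  · simp; omega
  · simp; omega

lemma isHamiltonian_top (hcard : 3 ≤ Fintype.card V) : (⊤ : SimpleGraph V).IsHamiltonian := by
  have hchain : (Finset.univ : Finset V).toList.IsChain (⊤ : SimpleGraph V).Adj :=
    (Finset.nodup_toList _).isChain
  have hne : (Finset.univ : Finset V).toList ≠ [] := by
    rw [← List.length_pos_iff, Finset.length_toList, Finset.card_univ]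
    omega
  have hp : (Walk.ofSupport _ hne hchain).IsHamiltonian := fun a ↦ by
    rw [Walk.support_ofSupport]
    exact List.count_eq_one_of_mem (Finset.nodup_toList _) (by simp)
  refine hp.isHamiltonian_of_adj hcard fun h ↦ ?_
  have hlen := hp.length_eq
  have := (hp.isPath.getVert_eq_end_iff (Nat.zero_le _)).mp (by simpa using h.symm)
  omega

/-- If adding the edge `uv` makes a graph Hamiltonian, then either it already was or it has a
Hamiltonian path from `u` to `v`. -/
lemma exists_isHamiltonian_walk_of_sup_edge (hG : ¬ G.IsHamiltonian) (huv : u ≠ v)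
    (h : (G ⊔ edge u v).IsHamiltonian) : ∃ p : G.Walk u v, p.IsHamiltonian := by
  have : Nontrivial V := ⟨u, v, huv⟩
  have mem_edgeSet {e} (he : e ∈ (G ⊔ edge u v).edgeSet) (hne : e ≠ s(u, v)) :
      e ∈ G.edgeSet := by
    rw [edgeSet_sup, edgeSet_edge_of_ne huv] at he
    exact he.resolve_right hne
  obtain ⟨c, hc⟩ := h.exists_isHamiltonianCycle u
  by_cases hmem : s(u, v) ∈ c.edges
  · have of_snd {c : (G ⊔ edge u v).Walk u u} (hc : c.IsHamiltonianCycle) (hv : v = c.snd) :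
        ∃ p : G.Walk u v, p.IsHamiltonian := by
      cases c with
      | nil => exact absurd rfl hc.ne_nil
      | cons hadj q =>
        rw [Walk.snd_cons] at hv
        subst hv
        have hq := (Walk.cons_isCycle_iff q hadj).mp hc.isCycle
        have hq' : ∀ e ∈ q.edges, e ∈ G.edgeSet := fun e he ↦
          mem_edgeSet (q.edges_subset_edgeSet he) (by rintro rfl; exact hq.2 he)
        refine ⟨(q.transfer G hq').reverse, fun a ↦ ?_⟩
        simpa using hc.isHamiltonian_tail a
    cases c with
    | nil => exact absurd rfl hc.ne_nil
    | cons hadj q =>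
      rw [Walk.edges_cons, List.mem_cons] at hmem
      rcases hmem with hmem | hmem
      · exact of_snd hc (by simpa [huv.symm] using hmem)
      · have hq := (Walk.cons_isCycle_iff q hadj).mp hc.isCycle
        have hlen := hc.length_eq
        refine of_snd (c := (Walk.cons hadj q).reverse)
          (Walk.isHamiltonianCycle_iff_isCycle_and_length_eq.mpr
            ⟨hc.isCycle.reverse, by simpa using hlen⟩) ?_
        rw [Walk.snd_reverse, Walk.penultimate_cons_of_not_nil]
        · exact hq.1.eq_penultimate_of_mem_edges hmem
        · rw [← Walk.edges_eq_nil]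
          exact List.ne_nil_of_mem hmem
  · refine (hG fun _ ↦ ⟨u, c.transfer G fun e he ↦ mem_edgeSet (c.edges_subset_edgeSet he)
      (by rintro rfl; exact hmem he), ?_⟩).elim
    exact Walk.isHamiltonianCycle_iff_isCycle_and_length_eq.mpr
      ⟨hc.isCycle.transfer _, by simpa using hc.length_eq⟩

/-- A Hamiltonian path from `u` to `v` with crossing chords at `u` and `v` yields a Hamiltonian
cycle. -/
lemma Walk.IsHamiltonian.isHamiltonian_of_crossing {p : G.Walk u v} (hp : p.IsHamiltonian)
    (hcard : 3 ≤ Fintype.card V) {i : ℕ} (hi : i < p.length)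
    (hu : G.Adj u (p.getVert (i + 1))) (hv : G.Adj v (p.getVert i)) : G.IsHamiltonian := by
  let q := (p.take i).reverse.append (.cons hu (p.drop (i + 1)))
  have hq : q.IsHamiltonian := fun a ↦ by
    rw [← hp a]
    simp only [q, Walk.support_append, Walk.support_reverse, Walk.support_take,
      Walk.support_cons, List.tail_cons, Walk.drop_support_eq_support_drop_min,
      List.count_append, List.count_reverse]
    rw [min_eq_left (by omega), ← List.count_append, List.take_append_drop]
  exact hq.isHamiltonian_of_adj hcard hv

open Classical in
/-- In a nonhamiltonian graph, the endpoints of a Hamiltonian path have degree sum less than the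
number of vertices, and there are `deg u` vertices other than `v` not adjacent to `v`. -/
lemma Walk.IsHamiltonian.degree_add_degree_lt {p : G.Walk u v} (hp : p.IsHamiltonian)
    (hcard : 3 ≤ Fintype.card V) (hG : ¬ G.IsHamiltonian) :
    G.degree u + G.degree v < Fintype.card V ∧
      ∃ S : Finset V, S.card = G.degree u ∧ ∀ x ∈ S, x ≠ v ∧ ¬ G.Adj x v := by
  have hlen := hp.length_eq
  have inj := hp.isPath.getVert_injOn
  let I := {i ∈ Finset.range p.length | G.Adj u (p.getVert (i + 1))}
  let J := {i ∈ Finset.range p.length | G.Adj v (p.getVert i)}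
  have hI : I.card = G.degree u := by
    rw [← card_neighborFinset_eq_degree]
    refine Finset.card_bij (fun i _ ↦ p.getVert (i + 1)) ?_ ?_ ?_
    · simp [I]
    · intro i hi j hj hij
      simp only [I, Finset.mem_filter, Finset.mem_range] at hi hj
      have := inj (x₁ := i + 1) (x₂ := j + 1) (by simp; omega) (by simp; omega) hij
      omega
    · intro x hx
      obtain ⟨i, rfl, hi⟩ := Walk.mem_support_iff_exists_getVert.mp (hp.mem_support x)
      cases i with
      | zero => simp at hx
      | succ i => exact ⟨i, by simpa [I] using ⟨hi, by simpa using hx⟩, rfl⟩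
  have hJ : J.card = G.degree v := by
    rw [← card_neighborFinset_eq_degree]
    refine Finset.card_bij (fun i _ ↦ p.getVert i) ?_ ?_ ?_
    · simp [J]
    · intro i hi j hj hij
      simp only [J, Finset.mem_filter, Finset.mem_range] at hi hj
      exact inj (by simp; omega) (by simp; omega) hij
    · intro x hx
      obtain ⟨i, rfl, hi⟩ := Walk.mem_support_iff_exists_getVert.mp (hp.mem_support x)
      rcases hi.lt_or_eq with hi | rfl
      · exact ⟨i, by simpa [J] using ⟨hi, by simpa using hx⟩, rfl⟩
      · simp at hx
  have hdisj : Disjoint I J := Finset.disjoint_left.mpr fun i hi hj ↦ by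
    simp only [I, J, Finset.mem_filter, Finset.mem_range] at hi hj
    exact hG (hp.isHamiltonian_of_crossing hcard hi.1 hi.2 hj.2)
  refine ⟨?_, I.image p.getVert, ?_, ?_⟩
  · have : (I ∪ J).card ≤ (Finset.range p.length).card :=
      Finset.card_le_card (Finset.union_subset (Finset.filter_subset _ _)
        (Finset.filter_subset _ _))
    rw [Finset.card_union_of_disjoint hdisj, hI, hJ, Finset.card_range] at this
    omega
  · rw [Finset.card_image_of_injOn, hI]
    refine inj.mono fun i hi ↦ ?_
    simp only [I, Finset.coe_filter, Finset.mem_range, Set.mem_ofPred_eq] at hi ⊢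
    omega
  · simp only [I, Finset.mem_image, Finset.mem_filter, Finset.mem_range]
    rintro _ ⟨i, ⟨hi, hu⟩, rfl⟩
    refine ⟨fun h ↦ ?_, fun h ↦ hG (hp.isHamiltonian_of_crossing hcard hi hu h.symm)⟩
    have := (hp.isPath.getVert_eq_end_iff hi.le).mp h
    omega

open Classical in
/-- Pósa's theorem for an edge-maximal nonhamiltonian graph. -/
lemma exists_card_eq_forall_degree_le_of_maximal (hcard : 3 ≤ Fintype.card V)
    (hG : Maximal (fun H : SimpleGraph V ↦ ¬ H.IsHamiltonian) G) :
    ∃ k : ℕ, 1 ≤ k ∧ k ≤ (Fintype.card V - 1) / 2 ∧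
      ∃ S : Finset V, S.card = k ∧ ∀ v ∈ S, G.degree v ≤ k := by
  let N : Finset (V × V) := {e | e.1 ≠ e.2 ∧ ¬ G.Adj e.1 e.2}
  have hN : N.Nonempty := by
    by_contra hN
    refine hG.prop ?_
    have : G = ⊤ := eq_top_iff.mpr fun x y hxy ↦ by
      by_contra hadj
      exact hN ⟨(x, y), by simpa [N] using ⟨hxy, hadj⟩⟩
    exact this ▸ isHamiltonian_top hcard
  obtain ⟨⟨u, v⟩, huv, hmax⟩ := N.exists_max_image (fun e ↦ G.degree e.1 + G.degree e.2) hN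
  wlog hle : G.degree u ≤ G.degree v generalizing u v
  · refine this v u ?_ (fun e he ↦ (hmax e he).trans_eq (add_comm _ _)) (le_of_not_ge hle)
    simpa [N, G.adj_comm, eq_comm] using huv
  simp only [N, Finset.mem_filter, Finset.mem_univ, true_and] at huv
  have hham : (G ⊔ edge u v).IsHamiltonian := by
    by_contra h
    exact hG.not_prop_of_gt (G.lt_sup_edge _ _ huv.1 huv.2) h
  obtain ⟨p, hp⟩ := exists_isHamiltonian_walk_of_sup_edge hG.prop huv.1 hham
  obtain ⟨hlt, S, hS, hSv⟩ := hp.degree_add_degree_lt hcard hG.prop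
  refine ⟨G.degree u, ?_, by omega, S, hS, fun x hx ↦ ?_⟩
  · exact (G.degree_pos_iff_exists_adj u).mpr
      ⟨_, p.adj_snd fun hnil ↦ huv.1 hnil.eq⟩
  · have := hmax (x, v) (by simpa [N] using hSv x hx)
    simpa using this

end SimpleGraph

theorem posa_contrapositive (n : ℕ) (hn : 3 ≤ n) (G : SimpleGraph (Fin n))
    [DecidableRel G.Adj] (hG : ¬ G.IsHamiltonian) :
    ∃ k : ℕ, 1 ≤ k ∧ k ≤ (n - 1) / 2 ∧
      ∃ S : Finset (Fin n), S.card = k ∧ ∀ v ∈ S, G.degree v ≤ k := by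
  classical
  obtain ⟨H, hGH, hH⟩ :=
    Finite.exists_le_maximal (p := fun H : SimpleGraph (Fin n) ↦ ¬ H.IsHamiltonian) hG
  obtain ⟨k, hk, hkn, S, hS, hdeg⟩ :=
    SimpleGraph.exists_card_eq_forall_degree_le_of_maximal (by simpa using hn) hH
  exact ⟨k, hk, by simpa using hkn, S, hS,
    fun v hv ↦ (SimpleGraph.degree_le_of_le hGH).trans (hdeg v hv)⟩
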